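/- Let F be a free group of rank n ≥ 2, let Δ be a decomposition of F with pieces P and constant R, let λ : P → ℝ be a bounded alternating function and φ = φ_{λ,Δ}. Let k₁ ≥ 1 and let ω₁ : F^{k₁} → ℝ be a bounded cocycle, with associated cochain η₁. Then the cochain β₁ := (−1)^{k₁} ω₁ ∪ φ − δη₁ ∈ C^{k₁+1}(F) satisfies δβ₁ = ω₁ ∪ δφ and is bounded on aligned tuples: there exists C ≥ 0 such that |β₁(g₁,…,g_{k₁}, g)| ≤ C for all (g₁,…,g_{k₁}, g) ∈ B^{k₁+1}. -/

import Mathlib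

open Finset

noncomputable section

/-- The space of inhomogeneous `k`-cochains on a group `G` with trivial real coefficients:
functions `G^k → ℝ`. -/
abbrev Cochain (G : Type*) (k : ℕ) := (Fin k → G) → ℝ

/-- The cup product of inhomogeneous cochains:
`(a ∪ b)(g₁,…,g_{k+l}) = a(g₁,…,g_k) · b(g_{k+1},…,g_{k+l})`. -/
def cup {G : Type*} {k l : ℕ} (a : Cochain G k) (b : Cochain G l) : Cochain G (k + l) :=
  fun g => a (fun i => g (Fin.castAdd l i)) * b (fun i => g (Fin.natAdd k i))

/-- The inhomogeneous coboundary
`(δφ)(g₁,…,g_{k+1}) = φ(g₂,…,g_{k+1}) + Σ_{i=1}^{k} (−1)^i φ(g₁,…,g_i g_{i+1},…,g_{k+1})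
  + (−1)^{k+1} φ(g₁,…,g_k)`. -/
def cobo {G : Type*} [Group G] {k : ℕ} (a : Cochain G k) : Cochain G (k + 1) :=
  fun g =>
    a (fun i => g i.succ)
      + ∑ i : Fin k, (-1 : ℝ) ^ ((i : ℕ) + 1) *
          a (fun j => if (j : ℕ) < (i : ℕ) then g (Fin.castSucc j)
              else if (j : ℕ) = (i : ℕ) then g (Fin.castSucc j) * g j.succ
              else g j.succ)
      + (-1 : ℝ) ^ (k + 1) * a (fun i => g (Fin.castSucc i))

/-- Transport of a cochain along an equality of degrees. -/
def copyC {G : Type*} {k l : ℕ} (h : k = l) (a : Cochain G k) : Cochain G l :=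
  fun g => a fun i => g (Fin.cast h i)

/-- A cochain is bounded if it has finite sup norm. -/
def IsBoundedCochain {G : Type*} {k : ℕ} (a : Cochain G k) : Prop :=
  ∃ C, ∀ g, |a g| ≤ C

/-- The sup norm `‖a‖_∞` of a cochain. -/
def supNorm {G : Type*} {k : ℕ} (a : Cochain G k) : ℝ := ⨆ g, |a g|

variable {α : Type*} [DecidableEq α]

/-- The product `g * h` in a free group is reduced: `|gh| = |g| + |h|`. -/
def ReducedProd (g h : FreeGroup α) : Prop :=
  (g * h).norm = g.norm + h.norm

/-- The aligned tuples `B^k`: all entries are nontrivial and each product of consecutive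
entries is reduced. -/
def Aligned {k : ℕ} (g : Fin k → FreeGroup α) : Prop :=
  (∀ i, g i ≠ 1) ∧ ∀ i j : Fin k, (j : ℕ) = (i : ℕ) + 1 → ReducedProd (g i) (g j)

/-- A cochain on a free group is bounded on aligned tuples. -/
def BoundedOnAligned {k : ℕ} (a : Cochain (FreeGroup α) k) : Prop :=
  ∃ C, ∀ g, Aligned g → |a g| ≤ C

/-- A decomposition of the free group on `α`, with pieces `P` and constant `R`, in the sense
of Heuer: a map `Δ` assigning to every group element a finite sequence of pieces satisfying
(i) `g` is the reduced product of its pieces; (ii) compatibility with inverses;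
(iii) every contiguous subword of a decomposition is a decomposition;
(iv) the thick part of every geodesic triangle consists of at most `R` pieces on each side. -/
structure Decomposition (α : Type*) [DecidableEq α] where
  P : Set (FreeGroup α)
  R : ℕ
  R_pos : 0 < R
  symm : ∀ p ∈ P, p⁻¹ ∈ P
  one_notMem : (1 : FreeGroup α) ∉ P
  Δ : FreeGroup α → List (FreeGroup α)
  piece_mem : ∀ g : FreeGroup α, ∀ p ∈ Δ g, p ∈ P
  prod_eq : ∀ g : FreeGroup α, (Δ g).prod = g
  norm_eq : ∀ g : FreeGroup α, g.norm = ((Δ g).map FreeGroup.norm).sum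
  inv_eq : ∀ g : FreeGroup α, Δ (g⁻¹) = ((Δ g).reverse.map fun p => p⁻¹)
  infix_eq : ∀ (g : FreeGroup α) (l₁ l₂ l₃ : List (FreeGroup α)),
    Δ g = l₁ ++ l₂ ++ l₃ → Δ l₂.prod = l₂
  triangle : ∀ g h : FreeGroup α, ∃ c₁ c₂ c₃ r₁ r₂ r₃ : FreeGroup α,
    Δ g = Δ (c₁⁻¹) ++ Δ r₁ ++ Δ c₂ ∧
    Δ h = Δ (c₂⁻¹) ++ Δ r₂ ++ Δ c₃ ∧
    Δ ((g * h)⁻¹) = Δ (c₃⁻¹) ++ Δ r₃ ++ Δ c₁ ∧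
    (Δ r₁).length ≤ R ∧ (Δ r₂).length ≤ R ∧ (Δ r₃).length ≤ R

/-- `λ` is alternating on the pieces: `λ(p⁻¹) = −λ(p)`. -/
def IsAlternatingOnPieces (D : Decomposition α) (lam : FreeGroup α → ℝ) : Prop :=
  ∀ p ∈ D.P, lam p⁻¹ = -lam p

/-- `λ` is bounded on the pieces. -/
def BoundedOnPieces (D : Decomposition α) (lam : FreeGroup α → ℝ) : Prop :=
  ∃ C, ∀ p ∈ D.P, |lam p| ≤ C

/-- The `Δ`-decomposable quasi-morphism `φ_{λ,Δ}(g) = Σ_j λ(g^{(j)})`. -/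
def qm (D : Decomposition α) (lam : FreeGroup α → ℝ) (g : FreeGroup α) : ℝ :=
  ((D.Δ g).map lam).sum

/-- `φ_{λ,Δ}` viewed as a `1`-cochain. -/
def qmC (D : Decomposition α) (lam : FreeGroup α → ℝ) : Cochain (FreeGroup α) 1 :=
  fun g => qm D lam (g 0)

/-- `z^<_{j+1}(g)`: the product of the first `j` pieces of `g` (`j` is 0-indexed). -/
def zlt (D : Decomposition α) (g : FreeGroup α) (j : ℕ) : FreeGroup α :=
  ((D.Δ g).take j).prod

/-- `z^>_{j+1}(g)`: the product of the pieces of `g` after the `(j+1)`-st (`j` is 0-indexed). -/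
def zgt (D : Decomposition α) (g : FreeGroup α) (j : ℕ) : FreeGroup α :=
  ((D.Δ g).drop (j + 1)).prod

/-- `g^{(j+1)}`: the `(j+1)`-st piece of `g` (`j` is 0-indexed). -/
def piece (D : Decomposition α) (g : FreeGroup α) (j : ℕ) : FreeGroup α :=
  (D.Δ g).getD j 1

/-- `η₁(g₁,…,g_{k₁}) = Σ_{j=1}^{|Δ(g_{k₁})|} ω₁(g₁,…,g_{k₁−1}, z^<_j(g_{k₁}))·φ(g_{k₁}^{(j)})`. -/
def eta1 {m₁ : ℕ} (D : Decomposition α) (lam : FreeGroup α → ℝ)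
    (ω₁ : Cochain (FreeGroup α) (m₁ + 1)) : Cochain (FreeGroup α) (m₁ + 1) :=
  fun g => ∑ j ∈ Finset.range (D.Δ (g (Fin.last m₁))).length,
    ω₁ (Function.update g (Fin.last m₁) (zlt D (g (Fin.last m₁)) j)) *
      qm D lam (piece D (g (Fin.last m₁)) j)

/-- `η₂(h₁,…,h_{k₂}) = Σ_{j=1}^{|Δ(h₁)|} φ(h₁^{(j)})·ω₂(z^>_j(h₁), h₂,…,h_{k₂})`. -/
def eta2 {m₂ : ℕ} (D : Decomposition α) (lam : FreeGroup α → ℝ)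
    (ω₂ : Cochain (FreeGroup α) (m₂ + 1)) : Cochain (FreeGroup α) (m₂ + 1) :=
  fun h => ∑ j ∈ Finset.range (D.Δ (h 0)).length,
    qm D lam (piece D (h 0) j) * ω₂ (Function.update h 0 (zgt D (h 0) j))

/-- `η(g₁,…,g_{k₁−1}, e, h₂,…,h_{k₂})
  = Σ_{j=1}^{|Δ(e)|} ω₁(g₁,…,g_{k₁−1}, z^<_j(e))·φ(e^{(j)})·ω₂(z^>_j(e), h₂,…,h_{k₂})`,
where `e` sits in position `k₁` of the `(k₁+k₂−1)`-tuple. -/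
def etaM {m₁ m₂ : ℕ} (D : Decomposition α) (lam : FreeGroup α → ℝ)
    (ω₁ : Cochain (FreeGroup α) (m₁ + 1)) (ω₂ : Cochain (FreeGroup α) (m₂ + 1)) :
    Cochain (FreeGroup α) (m₁ + m₂ + 1) :=
  fun x =>
    ∑ j ∈ Finset.range (D.Δ (x ⟨m₁, by omega⟩)).length,
      ω₁ (Fin.snoc (fun i : Fin m₁ => x (Fin.castLE (by omega) i))
            (zlt D (x ⟨m₁, by omega⟩) j)) *
        qm D lam (piece D (x ⟨m₁, by omega⟩) j) *
        ω₂ (Fin.cons (zgt D (x ⟨m₁, by omega⟩) j)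
            (fun i : Fin m₂ => x ⟨m₁ + 1 + (i : ℕ), by have := i.isLt; omega⟩))

lemma cobo_eq_d {G : Type} [Group G] {k : ℕ} (a : Cochain G k) :
    cobo a = (inhomogeneousCochains.d (Rep.trivial ℝ G ℝ) k).hom a := by
  funext g
  rw [inhomogeneousCochains.d_hom_apply, Fin.sum_univ_castSucc]
  simp only [cobo, Rep.trivial_ρ_apply, smul_eq_mul, ← add_assoc]
  congr 1
  congr 3
  funext i
  unfold Fin.contractNth
  simp

lemma cobo_cobo {G : Type} [Group G] {k : ℕ} (a : Cochain G k) : cobo (cobo a) = 0 := by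
  rw [cobo_eq_d, cobo_eq_d]
  have := groupCohomology.inhomogeneousCochains.d_comp_d k (Rep.trivial ℝ G ℝ)
  have h2 := congrArg (fun f => f.hom a) this
  exact h2

lemma cobo_sub' {G : Type*} [Group G] {k : ℕ} (a b : Cochain G k) :
    cobo (a - b) = cobo a - cobo b := by
  funext g
  simp only [cobo, Pi.sub_apply, mul_sub, Finset.sum_sub_distrib]
  ring

lemma cobo_smul' {G : Type*} [Group G] {k : ℕ} (c : ℝ) (a : Cochain G k) :
    cobo (c • a) = c • cobo a := by
  funext g
  simp only [cobo, Pi.smul_apply, smul_eq_mul, mul_add, Finset.mul_sum]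
  congr 1
  · congr 1
    apply Finset.sum_congr rfl
    intros; ring
  · ring

lemma cobo_cup_one {G : Type*} [Group G] {k : ℕ} (a : Cochain G k) (b : Cochain G 1) :
    cobo (cup a b) = cup (cobo a) b + (-1 : ℝ) ^ k • cup a (cobo b) := by
  funext g
  have e1 : ∀ i : Fin k, (fun j : Fin k => if ((Fin.castAdd 1 j : Fin (k+1)) : ℕ) < ((Fin.castSucc i : Fin (k+1)) : ℕ)
        then g (Fin.castSucc (Fin.castAdd 1 j))
        else if ((Fin.castAdd 1 j : Fin (k+1)) : ℕ) = ((Fin.castSucc i : Fin (k+1)) : ℕ) then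
          g (Fin.castSucc (Fin.castAdd 1 j)) * g (Fin.castAdd 1 j).succ
        else g (Fin.castAdd 1 j).succ) =
      (fun j : Fin k => if (j : ℕ) < (i : ℕ) then g (Fin.castAdd 1 (Fin.castSucc j))
              else if (j : ℕ) = (i : ℕ) then g (Fin.castAdd 1 (Fin.castSucc j)) * g (Fin.castAdd 1 j.succ)
              else g (Fin.castAdd 1 j.succ)) := fun i => rfl
  have e2 : ∀ i : Fin k, (fun j : Fin 1 => if ((Fin.natAdd k j : Fin (k+1)) : ℕ) < ((Fin.castSucc i : Fin (k+1)) : ℕ)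
        then g (Fin.castSucc (Fin.natAdd k j))
        else if ((Fin.natAdd k j : Fin (k+1)) : ℕ) = ((Fin.castSucc i : Fin (k+1)) : ℕ) then
          g (Fin.castSucc (Fin.natAdd k j)) * g (Fin.natAdd k j).succ
        else g (Fin.natAdd k j).succ) = fun j => g (Fin.natAdd (k+1) j) := by
    intro i; funext j
    have h1 : ¬ (k + (j:ℕ) < i) := by omega
    have h2 : ¬ (k + (j:ℕ) = i) := by omega
    simp only [Fin.val_natAdd, Fin.val_castSucc, h1, h2, if_false]
    congr 1
    ext; simp <;> omega
  have e3 : (fun j : Fin k => if ((Fin.castAdd 1 j : Fin (k+1)) : ℕ) < ((Fin.last k : Fin (k+1)) : ℕ)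
        then g (Fin.castSucc (Fin.castAdd 1 j))
        else if ((Fin.castAdd 1 j : Fin (k+1)) : ℕ) = ((Fin.last k : Fin (k+1)) : ℕ) then
          g (Fin.castSucc (Fin.castAdd 1 j)) * g (Fin.castAdd 1 j).succ
        else g (Fin.castAdd 1 j).succ) = fun j => g (Fin.castAdd 2 j) := by
    funext j
    have : (j:ℕ) < k := j.2
    simp [this]; rfl
  have e4 : (fun j : Fin 1 => if ((Fin.natAdd k j : Fin (k+1)) : ℕ) < ((Fin.last k : Fin (k+1)) : ℕ)
        then g (Fin.castSucc (Fin.natAdd k j))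
        else if ((Fin.natAdd k j : Fin (k+1)) : ℕ) = ((Fin.last k : Fin (k+1)) : ℕ) then
          g (Fin.castSucc (Fin.natAdd k j)) * g (Fin.natAdd k j).succ
        else g (Fin.natAdd k j).succ) =
        (fun j : Fin 1 => if (j : ℕ) < ((0 : Fin 1) : ℕ) then g (Fin.natAdd k (Fin.castSucc j))
              else if (j : ℕ) = ((0 : Fin 1) : ℕ) then g (Fin.natAdd k (Fin.castSucc j)) * g (Fin.natAdd k j.succ)
              else g (Fin.natAdd k j.succ)) := by
    funext j
    have : j = 0 := Subsingleton.elim _ _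
    subst this
    simp; rfl
  simp only [Pi.add_apply, Pi.smul_apply, smul_eq_mul]
  unfold cobo cup
  simp only [Fin.sum_univ_castSucc (n := k), e1, e2, e3, e4, Fin.sum_univ_one]
  have f1 : (fun i : Fin 1 => g (Fin.natAdd k i).succ) = fun i => g (Fin.natAdd (k+1) i) := by
    funext j; congr 1; ext; simp <;> omega
  have f2 : (fun i : Fin 1 => g (Fin.natAdd k i.succ)) = fun i => g (Fin.natAdd (k+1) i) := by
    funext j; congr 1; ext; simp <;> omega
  have f3 : (fun i : Fin k => g (Fin.castAdd 1 i).succ) = fun i => g (Fin.castAdd 1 i.succ) := rfl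
  have f4 : (fun i : Fin k => g (Fin.castAdd 1 i).castSucc) = fun i => g (Fin.castAdd 2 i) := rfl
  have f5 : (fun i : Fin k => g (Fin.castAdd 1 i.castSucc)) = fun i => g (Fin.castAdd 2 i) := rfl
  have f6 : (fun i : Fin 1 => g (Fin.natAdd k i).castSucc) = fun i => g (Fin.natAdd k i.castSucc) := rfl
  simp only [f1, f2, f3, f4, f5, f6, ← mul_assoc, ← Finset.sum_mul]
  simp only [Fin.val_last, Fin.val_castSucc, Fin.val_zero]
  ring

/-- Path sum along a list of pieces. -/
def pathSum {G : Type*} [Group G] (f lam : G → ℝ) : G → List G → ℝ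
  | _, [] => 0
  | x, p :: l => f x * lam p + pathSum f lam (x * p) l

lemma pathSum_append {G : Type*} [Group G] (f lam : G → ℝ) (x : G) (l l' : List G) :
    pathSum f lam x (l ++ l') = pathSum f lam x l + pathSum f lam (x * l.prod) l' := by
  induction l generalizing x with
  | nil => simp [pathSum]
  | cons p l ih => simp [pathSum, ih, add_assoc, mul_assoc]

lemma pathSum_bound {G : Type*} [Group G] (f lam : G → ℝ) (A B : ℝ) (hf : ∀ x, |f x| ≤ A)
    (x : G) (l : List G) (hl : ∀ p ∈ l, |lam p| ≤ B) :
    |pathSum f lam x l| ≤ l.length * (A * B) := by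
  induction l generalizing x with
  | nil => simp [pathSum]
  | cons p l ih =>
    have h1 := ih (x * p) (fun q hq => hl q (List.mem_cons_of_mem _ hq))
    have h2 : |f x * lam p| ≤ A * B := by
      rw [abs_mul]
      exact mul_le_mul (hf x) (hl p (by simp)) (abs_nonneg _) ((abs_nonneg _).trans (hf x))
    simp only [pathSum, List.length_cons]
    push_cast
    refine (abs_add_le _ _).trans ?_
    linarith

lemma pathSum_eq_sum {G : Type*} [Group G] (f lam : G → ℝ) (x : G) (l : List G) :
    pathSum f lam x l =
      ∑ j ∈ Finset.range l.length, f (x * (l.take j).prod) * lam (l.getD j 1) := by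
  induction l generalizing x with
  | nil => simp [pathSum]
  | cons p l ih =>
    rw [List.length_cons, Finset.sum_range_succ', pathSum, ih]
    simp [mul_assoc, add_comm]

lemma delta_piece (D : Decomposition α) (g p : FreeGroup α) (hp : p ∈ D.Δ g) : D.Δ p = [p] := by
  obtain ⟨s, t, h⟩ := List.append_of_mem hp
  have := D.infix_eq g s [p] t (by simp [h])
  simpa using this

lemma qm_piece (D : Decomposition α) (lam : FreeGroup α → ℝ) (g : FreeGroup α) (j : ℕ)
    (hj : j < (D.Δ g).length) : qm D lam (piece D g j) = lam ((D.Δ g).getD j 1) := by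
  have : piece D g j ∈ D.Δ g := by
    simp [piece, hj]
  rw [qm, delta_piece D g _ this]
  simp [piece]

lemma delta_one (D : Decomposition α) : D.Δ 1 = [] := by
  by_contra h
  obtain ⟨p, l, hl⟩ := List.exists_cons_of_ne_nil h
  have h1 := D.norm_eq 1
  rw [hl] at h1
  rw [FreeGroup.norm_one, List.map_cons, List.sum_cons] at h1
  have h3 : p = 1 := FreeGroup.norm_eq_zero.1 (by omega)
  have h2 := D.piece_mem 1 p (by simp [hl])
  exact D.one_notMem (h3 ▸ h2)

lemma core_bound (D : Decomposition α) (f lam : FreeGroup α → ℝ) (A B : ℝ)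
    (hf : ∀ x, |f x| ≤ A) (hl : ∀ p ∈ D.P, |lam p| ≤ B) (h g : FreeGroup α)
    (hr : ReducedProd h g) :
    |pathSum f lam h (D.Δ g) + pathSum f lam 1 (D.Δ h) - pathSum f lam 1 (D.Δ (h * g))|
      ≤ 3 * (D.R * |A * B|) := by
  obtain ⟨c₁, c₂, c₃, r₁, r₂, r₃, t1, t2, t3, l1, l2, l3⟩ := D.triangle h g
  have bd : ∀ (x r : FreeGroup α), (D.Δ r).length ≤ D.R →
      |pathSum f lam x (D.Δ r)| ≤ D.R * |A * B| := by
    intro x r hlen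
    refine (pathSum_bound f lam A B hf x _ (fun p hp => hl p (D.piece_mem _ p hp))).trans ?_
    have : ((D.Δ r).length : ℝ) ≤ D.R := by exact_mod_cast hlen
    calc ((D.Δ r).length : ℝ) * (A * B) ≤ (D.Δ r).length * |A * B| :=
          mul_le_mul_of_nonneg_left (le_abs_self _) (by positivity)
      _ ≤ _ := mul_le_mul_of_nonneg_right this (abs_nonneg _)
  have p1 : h = c₁⁻¹ * r₁ * c₂ := by
    have := congrArg List.prod t1
    simpa [D.prod_eq, mul_assoc] using this
  have p2 : g = c₂⁻¹ * r₂ * c₃ := by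
    have := congrArg List.prod t2
    simpa [D.prod_eq, mul_assoc] using this
  have p3 : (h * g)⁻¹ = c₃⁻¹ * r₃ * c₁ := by
    have := congrArg List.prod t3
    simpa only [D.prod_eq, mul_assoc, List.prod_append] using this
  have n1 : h.norm = c₁.norm + r₁.norm + c₂.norm := by
    have := D.norm_eq h
    rw [t1] at this
    simpa [← D.norm_eq, add_assoc] using this
  have n2 : g.norm = c₂.norm + r₂.norm + c₃.norm := by
    have := D.norm_eq g
    rw [t2] at this
    simpa [← D.norm_eq, add_assoc] using this
  have hc2 : c₂ = 1 := by
    rw [← FreeGroup.norm_eq_zero]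
    unfold ReducedProd at hr
    have e : h * g = c₁⁻¹ * r₁ * (r₂ * c₃) := by rw [p1, p2]; group
    have a1 := FreeGroup.norm_mul_le (c₁⁻¹ * r₁) (r₂ * c₃)
    have a2 := FreeGroup.norm_mul_le (c₁⁻¹) r₁
    have a3 := FreeGroup.norm_mul_le r₂ c₃
    rw [← e] at a1
    rw [FreeGroup.norm_inv_eq] at a2
    omega
  subst hc2
  rw [inv_one] at t2 p2
  rw [delta_one] at t1 t2
  have t4 : D.Δ (h * g) = D.Δ c₁⁻¹ ++ D.Δ r₃⁻¹ ++ D.Δ c₃ := by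
    have := D.inv_eq (h * g)⁻¹
    rw [inv_inv, t3] at this
    rw [this]
    have e3 := D.inv_eq c₃⁻¹
    rw [inv_inv] at e3
    rw [e3, D.inv_eq c₁, D.inv_eq r₃]
    simp
  have l3' : (D.Δ r₃⁻¹).length ≤ D.R := by
    rw [D.inv_eq]; simpa using l3
  have key : h * r₂ = c₁⁻¹ * r₃⁻¹ := by
    have : h * g = c₁⁻¹ * r₃⁻¹ * c₃ := by
      rw [← inv_inv (h * g), p3]; group
    rw [p2] at this
    simpa [← mul_assoc] using this
  rw [t4, t1, t2]
  simp only [pathSum_append, List.append_nil, List.nil_append, D.prod_eq, List.prod_append,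
    one_mul, key]
  have b1 := bd c₁⁻¹ r₁ l1
  have b2 := bd h r₂ l2
  have b3 := bd c₁⁻¹ r₃⁻¹ l3'
  rw [abs_le] at *
  constructor <;> linarith [b1.1, b1.2, b2.1, b2.2, b3.1, b3.2]

lemma eta1_eq {m : ℕ} (D : Decomposition α) (lam : FreeGroup α → ℝ)
    (ω : Cochain (FreeGroup α) (m + 1)) (v : Fin (m + 1) → FreeGroup α) :
    eta1 D lam ω v = pathSum (fun x => ω (Function.update v (Fin.last m) x)) lam 1
      (D.Δ (v (Fin.last m))) := by
  rw [pathSum_eq_sum, eta1]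
  apply Finset.sum_congr rfl
  intro j hj
  rw [qm_piece D lam _ j (Finset.mem_range.1 hj), one_mul, zlt]

lemma qm_eq (D : Decomposition α) (lam : FreeGroup α → ℝ) (g : FreeGroup α) :
    qm D lam g = ∑ j ∈ Finset.range (D.Δ g).length, lam ((D.Δ g).getD j 1) := by
  have h := pathSum_eq_sum (fun _ : FreeGroup α => (1 : ℝ)) lam 1 (D.Δ g)
  simp only [one_mul] at h
  rw [← h, qm]
  generalize D.Δ g = l
  generalize (1 : FreeGroup α) = x
  induction l generalizing x with
  | nil => rfl
  | cons p l ih => simp [pathSum, ih (x * p)]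

/-- The inner face map. -/
def face {G : Type*} [Group G] {k : ℕ} (i : ℕ) (g : Fin (k + 1) → G) : Fin k → G :=
  fun j => if (j : ℕ) < i then g (Fin.castSucc j)
              else if (j : ℕ) = i then g (Fin.castSucc j) * g j.succ
              else g j.succ

lemma cobo_face {G : Type*} [Group G] {k : ℕ} (a : Cochain G (k + 1)) (w : Fin (k + 2) → G) :
    cobo a w = a (fun i => w i.succ)
      + ∑ i : Fin k, (-1 : ℝ) ^ ((i : ℕ) + 1) * a (face i w)
      + (-1 : ℝ) ^ (k + 1) * a (Function.update (fun i => w (Fin.castSucc i)) (Fin.last k)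
          (w (Fin.last k).castSucc * w (Fin.last (k + 1))))
      + (-1 : ℝ) ^ (k + 2) * a (fun i => w (Fin.castSucc i)) := by
  have e : face k w = Function.update (fun i => w (Fin.castSucc i)) (Fin.last k)
          (w (Fin.last k).castSucc * w (Fin.last (k + 1))) := by
    funext j
    rcases Fin.eq_castSucc_or_eq_last j with ⟨j, rfl⟩ | rfl
    · simp [face]
    · simp [face]
  rw [← e, cobo, Fin.sum_univ_castSucc]
  simp only [Fin.val_last, Fin.val_castSucc, add_assoc]
  rfl

lemma beta_formula {m : ℕ} (D : Decomposition α) (lam : FreeGroup α → ℝ)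
    (ω : Cochain (FreeGroup α) (m + 1)) (hc : cobo ω = 0) (w : Fin (m + 2) → FreeGroup α)
    (f : FreeGroup α → ℝ)
    (hf : f = fun x => ω (Function.update (fun i => w (Fin.castSucc i)) (Fin.last m) x)) :
    ((-1 : ℝ) ^ (m + 1) • cup ω (qmC D lam) - cobo (eta1 D lam ω)) w =
      (-1 : ℝ) ^ (m + 1) * (pathSum f lam (w (Fin.last m).castSucc) (D.Δ (w (Fin.last (m + 1))))
        + pathSum f lam 1 (D.Δ (w (Fin.last m).castSucc))
        - pathSum f lam 1 (D.Δ (w (Fin.last m).castSucc * w (Fin.last (m + 1))))) := by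
  set g := w (Fin.last (m + 1)) with hg
  set h := w (Fin.last m).castSucc with hh
  have hcup : cup ω (qmC D lam) w = ω (fun i => w (Fin.castSucc i)) * qm D lam g := rfl
  have E0 : eta1 D lam ω (fun i => w i.succ) = ∑ j ∈ Finset.range (D.Δ g).length,
      ω (fun i => Function.update w (Fin.last (m + 1)) ((D.Δ g).take j).prod i.succ) *
        lam ((D.Δ g).getD j 1) := by
    rw [eta1_eq, pathSum_eq_sum]
    simp only [Fin.succ_last, ← hg, one_mul]
    apply Finset.sum_congr rfl
    intro j _
    congr 2
    funext i
    rcases Fin.eq_castSucc_or_eq_last i with ⟨i, rfl⟩ | rfl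
    · simp [Fin.succ_castSucc, -Fin.castSucc_succ]
    · simp
  have E1 : ∀ i : Fin m, eta1 D lam ω (face i w) = ∑ j ∈ Finset.range (D.Δ g).length,
      ω (face i (Function.update w (Fin.last (m + 1)) ((D.Δ g).take j).prod)) *
        lam ((D.Δ g).getD j 1) := by
    intro i
    have hl : ∀ v : Fin (m + 2) → FreeGroup α, face (i : ℕ) v (Fin.last m) = v (Fin.last (m + 1)) := by
      intro v
      have h1 : ¬ (m < (i : ℕ)) := by omega
      have h2 : ¬ (m = (i : ℕ)) := by omega
      simp [face, h1, h2]
    rw [eta1_eq, pathSum_eq_sum, hl]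
    simp only [← hg, one_mul]
    apply Finset.sum_congr rfl
    intro j _
    congr 2
    funext q
    rcases Fin.eq_castSucc_or_eq_last q with ⟨q, rfl⟩ | rfl
    · simp [face, Fin.succ_castSucc, -Fin.castSucc_succ]
    · rw [hl]; simp
  have E2 : eta1 D lam ω (Function.update (fun i => w (Fin.castSucc i)) (Fin.last m) (h * g))
      = pathSum f lam 1 (D.Δ (h * g)) := by
    rw [eta1_eq, hf]; simp
  have E3 : eta1 D lam ω (fun i => w (Fin.castSucc i)) = pathSum f lam 1 (D.Δ h) := by
    rw [eta1_eq, hf]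
  have C : ∀ z, ω (fun i => Function.update w (Fin.last (m + 1)) z i.succ)
      + ∑ i : Fin m, (-1 : ℝ) ^ ((i : ℕ) + 1) * ω (face i (Function.update w (Fin.last (m + 1)) z))
      = (-1 : ℝ) ^ (m + 1) * (ω (fun i => w (Fin.castSucc i)) - f (h * z)) := by
    intro z
    have := congrFun hc (Function.update w (Fin.last (m + 1)) z)
    rw [cobo_face] at this
    have e : (fun i : Fin (m + 1) => Function.update w (Fin.last (m + 1)) z i.castSucc) =
        fun i => w i.castSucc := by
      funext i; simp
    rw [e] at this
    simp only [Function.update_self, ne_eq, Fin.castSucc_ne_last, not_false_eq_true,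
      Function.update_of_ne, Pi.zero_apply, ← hh] at this
    rw [hf]
    rw [pow_succ _ (m + 1)] at this
    linear_combination this
  rw [Pi.sub_apply, Pi.smul_apply, smul_eq_mul, hcup, cobo_face, ← hh, ← hg, E0, E2, E3]
  simp only [E1, Finset.mul_sum]
  rw [Finset.sum_comm, ← Finset.sum_add_distrib]
  have S : ∀ j ∈ Finset.range (D.Δ g).length,
      (ω (fun i => Function.update w (Fin.last (m + 1)) ((D.Δ g).take j).prod i.succ) *
        lam ((D.Δ g).getD j 1) + ∑ i : Fin m, (-1 : ℝ) ^ ((i : ℕ) + 1) *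
        (ω (face i (Function.update w (Fin.last (m + 1)) ((D.Δ g).take j).prod)) *
        lam ((D.Δ g).getD j 1))) = (-1 : ℝ) ^ (m + 1) * (ω (fun i => w (Fin.castSucc i)) *
          lam ((D.Δ g).getD j 1)) -
          (-1 : ℝ) ^ (m + 1) * (f (h * ((D.Δ g).take j).prod) * lam ((D.Δ g).getD j 1)) := by
    intro j _
    simp only [← mul_assoc, ← Finset.sum_mul]
    rw [← add_mul, C]
    ring
  rw [Finset.sum_congr rfl S, Finset.sum_sub_distrib, ← Finset.mul_sum, ← Finset.mul_sum,
    ← Finset.mul_sum, ← qm_eq, ← pathSum_eq_sum]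
  ring

/-- The cochain `β₁ := (−1)^{k₁} ω₁ ∪ φ − δη₁` satisfies `δβ₁ = ω₁ ∪ δφ` and is bounded on
aligned tuples. -/
theorem beta₁_primitive_and_bounded
    (n : ℕ) (hn : 2 ≤ n) (D : Decomposition (Fin n)) (lam : FreeGroup (Fin n) → ℝ)
    (hAlt : IsAlternatingOnPieces D lam) (hBdd : BoundedOnPieces D lam)
    (m₁ : ℕ) (ω₁ : Cochain (FreeGroup (Fin n)) (m₁ + 1))
    (hω₁ : IsBoundedCochain ω₁) (hc₁ : cobo ω₁ = 0) :
    cobo ((-1 : ℝ) ^ (m₁ + 1) • cup ω₁ (qmC D lam) - cobo (eta1 D lam ω₁))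
        = cup ω₁ (cobo (qmC D lam)) ∧
      BoundedOnAligned ((-1 : ℝ) ^ (m₁ + 1) • cup ω₁ (qmC D lam) - cobo (eta1 D lam ω₁)) := by
  constructor
  · rw [cobo_sub', cobo_cobo, cobo_smul', cobo_cup_one, hc₁, sub_zero, smul_add, smul_smul,
      ← pow_add, Even.neg_one_pow ⟨_, rfl⟩, one_smul]
    have : cup (0 : Cochain (FreeGroup (Fin n)) (m₁ + 1 + 1)) (qmC D lam) = 0 := by
      funext g; simp [cup]
    rw [this, smul_zero, zero_add]
  · obtain ⟨A, hA⟩ := hω₁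
    obtain ⟨B, hB⟩ := hBdd
    refine ⟨3 * (D.R * |A * B|), fun w hw => ?_⟩
    rw [beta_formula D lam ω₁ hc₁ w _ rfl, abs_mul, abs_pow, abs_neg, abs_one, one_pow, one_mul]
    exact core_bound D _ lam A B (fun x => hA _) hB _ _ (hw.2 _ _ (by simp))
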